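/- Let H be a graded Hopf algebra and (G,μ,λ) a graded left H-comodule algebra. Let (H[t]/(t^{l+1}), m^l, Δ^l) be an l-deformation of H and (G[t]/(t^{l+1}), μ^l, λ^l) an l-deformation of G compatible with the deformation of H, with degree −s components μ^l_s, m^l_s, λ^l_s, Δ^l_s. Then the total 2-cochain ((μ^l₁, m^l₁), (λ^l₁, Δ^l₁)) is a 2-cocycle in the total complex of the deformation bicomplex 𝒞^{*,*}(G,H), i.e. it lies in Z²_{ca}(G,H). -/

import Mathlib

open TensorProduct

noncomputable section

namespace HopfPaper

variable (k : Type) [CommRing k]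

/-- The image submodule `p ⊗ q ⊆ M ⊗ N` of a pair of submodules. -/
def tsub {M N : Type} [AddCommGroup M] [Module k M] [AddCommGroup N] [Module k N]
    (p : Submodule k M) (q : Submodule k N) : Submodule k (M ⊗[k] N) :=
  LinearMap.range (TensorProduct.mapIncl p q)

/-- A left `H`-comodule algebra structure on the `k`-algebra `A`:
an algebra map `λ : A → H ⊗ A` which is coassociative and counital. -/
structure ComodAlg (H A : Type) [Ring H] [HopfAlgebra k H] [Ring A] [Algebra k A] where
  lam : A →ₐ[k] H ⊗[k] A
  coassoc : (Coalgebra.comul (R := k) (A := H)).rTensor A ∘ₗ lam.toLinearMap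
      = (TensorProduct.assoc k H H A).symm.toLinearMap ∘ₗ
          lam.toLinearMap.lTensor H ∘ₗ lam.toLinearMap
  counital : (Coalgebra.counit (R := k) (A := H)).rTensor A ∘ₗ lam.toLinearMap
      = TensorProduct.mk k k A 1

variable {k}

/-- A right ideal of `A` which is costable under the coaction, i.e. `λ(J) ⊆ H ⊗ J`. -/
def ComodAlg.IsCostableRightIdeal {H A : Type} [Ring H] [HopfAlgebra k H] [Ring A] [Algebra k A]
    (c : ComodAlg k H A) (J : Submodule k A) : Prop :=
  (∀ j ∈ J, ∀ a : A, j * a ∈ J) ∧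
    Submodule.map c.lam.toLinearMap J ≤ tsub k (⊤ : Submodule k H) J

/-- `A` is right `H`-simple: it has no nontrivial `H`-costable right ideal. -/
def ComodAlg.RightSimple {H A : Type} [Ring H] [HopfAlgebra k H] [Ring A] [Algebra k A]
    (c : ComodAlg k H A) : Prop :=
  ∀ J : Submodule k A, c.IsCostableRightIdeal J → J = ⊥ ∨ J = ⊤

/-- The coinvariants of `A` are trivial: `A^{co H} = k`. -/
def ComodAlg.TrivialCoinv {H A : Type} [Ring H] [HopfAlgebra k H] [Ring A] [Algebra k A]
    (c : ComodAlg k H A) : Prop :=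
  ∀ a : A, c.lam a = 1 ⊗ₜ[k] a ↔ ∃ t : k, a = t • (1 : A)

end HopfPaper

set_option maxHeartbeats 1000000
set_option synthInstance.maxHeartbeats 400000

namespace HopfPaper

section Z2

variable (k : Type) [CommRing k] (H : Type) [Ring H] [HopfAlgebra k H]
  (G : Type) [Ring G] [Algebra k G] (c : ComodAlg k H G)

/-- `λ²₁ : G⊗G → H⊗(G⊗G)`, `a⊗b ↦ a₍₋₁₎b₍₋₁₎ ⊗ (a₍₀₎⊗b₍₀₎)`. -/
def lam21 : G ⊗[k] G →ₗ[k] H ⊗[k] (G ⊗[k] G) :=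
  (LinearMap.mul' k H).rTensor (G ⊗[k] G) ∘ₗ
    (TensorProduct.tensorTensorTensorComm k H G H G).toLinearMap ∘ₗ
    TensorProduct.map c.lam.toLinearMap c.lam.toLinearMap

/-- `λ²₂ : G⊗G → (H⊗H)⊗G`, `a⊗b ↦ (a₍₋₁₎⊗b₍₋₁₎) ⊗ a₍₀₎b₍₀₎`. -/
def lam22 : G ⊗[k] G →ₗ[k] (H ⊗[k] H) ⊗[k] G :=
  (LinearMap.mul' k G).lTensor (H ⊗[k] H) ∘ₗ
    (TensorProduct.tensorTensorTensorComm k H G H G).toLinearMap ∘ₗ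
    TensorProduct.map c.lam.toLinearMap c.lam.toLinearMap

/-- `β¹_l : G ⊗ (H⊗G) → H⊗G`, `a ⊗ (y⊗b) ↦ a₍₋₁₎y ⊗ a₍₀₎b`. -/
def beta1L : G ⊗[k] (H ⊗[k] G) →ₗ[k] H ⊗[k] G :=
  TensorProduct.map (LinearMap.mul' k H) (LinearMap.mul' k G) ∘ₗ
    (TensorProduct.tensorTensorTensorComm k H G H G).toLinearMap ∘ₗ
    c.lam.toLinearMap.rTensor (H ⊗[k] G)

/-- `β¹_r : (H⊗G) ⊗ G → H⊗G`, `(y⊗a) ⊗ b ↦ yb₍₋₁₎ ⊗ ab₍₀₎`. -/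
def beta1R : (H ⊗[k] G) ⊗[k] G →ₗ[k] H ⊗[k] G :=
  TensorProduct.map (LinearMap.mul' k H) (LinearMap.mul' k G) ∘ₗ
    (TensorProduct.tensorTensorTensorComm k H G H G).toLinearMap ∘ₗ
    c.lam.toLinearMap.lTensor (H ⊗[k] G)

/-- The left diagonal action `λ²_l : H ⊗ (H⊗H) → H⊗H`. -/
def diag2L : H ⊗[k] (H ⊗[k] H) →ₗ[k] H ⊗[k] H :=
  TensorProduct.map (LinearMap.mul' k H) (LinearMap.mul' k H) ∘ₗ
    (TensorProduct.tensorTensorTensorComm k H H H H).toLinearMap ∘ₗ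
    (Coalgebra.comul (R := k) (A := H)).rTensor (H ⊗[k] H)

/-- The right diagonal action `λ²_r : (H⊗H) ⊗ H → H⊗H`. -/
def diag2R : (H ⊗[k] H) ⊗[k] H →ₗ[k] H ⊗[k] H :=
  TensorProduct.map (LinearMap.mul' k H) (LinearMap.mul' k H) ∘ₗ
    (TensorProduct.tensorTensorTensorComm k H H H H).toLinearMap ∘ₗ
    (Coalgebra.comul (R := k) (A := H)).lTensor (H ⊗[k] H)

/-- `δ²_l : H⊗H → H⊗(H⊗H)`, `x⊗y ↦ x₁y₁ ⊗ (x₂⊗y₂)`. -/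
def codiag2L : H ⊗[k] H →ₗ[k] H ⊗[k] (H ⊗[k] H) :=
  (LinearMap.mul' k H).rTensor (H ⊗[k] H) ∘ₗ
    (TensorProduct.tensorTensorTensorComm k H H H H).toLinearMap ∘ₗ
    TensorProduct.map (Coalgebra.comul (R := k)) (Coalgebra.comul (R := k))

/-- `δ²_r : H⊗H → (H⊗H)⊗H`, `x⊗y ↦ (x₁⊗y₁) ⊗ x₂y₂`. -/
def codiag2R : H ⊗[k] H →ₗ[k] (H ⊗[k] H) ⊗[k] H :=
  (LinearMap.mul' k H).lTensor (H ⊗[k] H) ∘ₗ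
    (TensorProduct.tensorTensorTensorComm k H H H H).toLinearMap ∘ₗ
    TensorProduct.map (Coalgebra.comul (R := k)) (Coalgebra.comul (R := k))

/-- Membership in `Z²_{ca}(G,H)`: the explicit cocycle equations for an element
`(φ,f) + (ψ,g) ∈ 𝒞^{2,0}(G,H) ⊕ 𝒞^{1,1}(G,H)` of the total complex of the deformation
bicomplex. -/
def IsTwoCocycleCA (φ : G ⊗[k] G →ₗ[k] G) (f : H ⊗[k] H →ₗ[k] H)
    (ψ : G →ₗ[k] H ⊗[k] G) (g : H →ₗ[k] H ⊗[k] H) : Prop :=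
  -- ∂^h_{2,0} φ = 0:
  (LinearMap.mul' k G ∘ₗ φ.lTensor G ∘ₗ (TensorProduct.assoc k G G G).toLinearMap
      - φ ∘ₗ (LinearMap.mul' k G).rTensor G
      + φ ∘ₗ (LinearMap.mul' k G).lTensor G ∘ₗ (TensorProduct.assoc k G G G).toLinearMap
      - LinearMap.mul' k G ∘ₗ φ.rTensor G = 0) ∧
  -- ∂^v_{1,1} ψ − (g ⊗ id_G) λ = 0:
  (ψ.lTensor H ∘ₗ c.lam.toLinearMap
      - (TensorProduct.assoc k H H G).toLinearMap ∘ₗ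
          (Coalgebra.comul (R := k)).rTensor G ∘ₗ ψ
      + c.lam.toLinearMap.lTensor H ∘ₗ ψ
      - (TensorProduct.assoc k H H G).toLinearMap ∘ₗ g.rTensor G ∘ₗ c.lam.toLinearMap
    = 0) ∧
  -- ∂^h_{2,1} f = 0:
  (LinearMap.mul' k H ∘ₗ f.lTensor H ∘ₗ (TensorProduct.assoc k H H H).toLinearMap
      - f ∘ₗ (LinearMap.mul' k H).rTensor H
      + f ∘ₗ (LinearMap.mul' k H).lTensor H ∘ₗ (TensorProduct.assoc k H H H).toLinearMap
      - LinearMap.mul' k H ∘ₗ f.rTensor H = 0) ∧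
  -- ∂^v_{1,2} g = 0:
  (g.lTensor H ∘ₗ Coalgebra.comul (R := k)
      - (TensorProduct.assoc k H H H).toLinearMap ∘ₗ
          (Coalgebra.comul (R := k)).rTensor H ∘ₗ g
      + (Coalgebra.comul (R := k)).lTensor H ∘ₗ g
      - (TensorProduct.assoc k H H H).toLinearMap ∘ₗ
          g.rTensor H ∘ₗ Coalgebra.comul (R := k) = 0) ∧
  -- ∂^v_{2,1} f + ∂^h_{1,2} g = 0:
  ((f.lTensor H ∘ₗ codiag2L k H
      - Coalgebra.comul (R := k) ∘ₗ f
      + f.rTensor H ∘ₗ codiag2R k H)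
    + (diag2L k H ∘ₗ g.lTensor H
      - g ∘ₗ LinearMap.mul' k H
      + diag2R k H ∘ₗ g.rTensor H) = 0) ∧
  -- ∂^v_{2,0} φ + (f ⊗ id_G) λ²₂ + ∂^h_{1,1} ψ = 0:
  ((φ.lTensor H ∘ₗ lam21 k H G c - c.lam.toLinearMap ∘ₗ φ)
    + f.rTensor G ∘ₗ lam22 k H G c
    + (beta1L k H G c ∘ₗ ψ.lTensor G
      - ψ ∘ₗ LinearMap.mul' k G
      + beta1R k H G c ∘ₗ ψ.rTensor G) = 0)

end Z2

theorem alternating_sum_eq_zero_of_add_eq_add {A : Type*} [AddCommGroup A] {w x y z : A}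
    (h : z + x = w + y) : w - x + y - z = 0 := by
  rw [sub_add_eq_add_sub, ← h]
  abel

theorem alternating_sum_eq_zero_of_add_eq_add' {A : Type*} [AddCommGroup A] {w x y z : A}
    (h : x + z = y + w) : w - x + y - z = 0 := by
  rw [sub_add_eq_add_sub, add_comm w, ← h]
  abel

theorem add_sub_add_eq_zero_of_add_eq_add {A : Type*} [AddCommGroup A] {a b d e x y : A}
    (h : x + y = d + e + a + b) : a - x + b + (d - y + e) = 0 := by
  rw [← sub_eq_zero.mpr h.symm]
  abel

section TensorComp

variable {R M N P Q S : Type*} [CommSemiring R] [AddCommMonoid M] [AddCommMonoid N]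
  [AddCommMonoid P] [AddCommMonoid Q] [AddCommMonoid S] [Module R M] [Module R N] [Module R P]
  [Module R Q] [Module R S]

theorem lTensor_comp_rTensor_comp (f : M →ₗ[R] P) (g : N →ₗ[R] Q) (h : S →ₗ[R] M ⊗[R] N) :
    g.lTensor P ∘ₗ f.rTensor N ∘ₗ h = TensorProduct.map f g ∘ₗ h := by
  rw [← LinearMap.comp_assoc, LinearMap.lTensor_comp_rTensor]

theorem rTensor_comp_lTensor_comp (f : M →ₗ[R] P) (g : N →ₗ[R] Q) (h : S →ₗ[R] M ⊗[R] N) :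
    f.rTensor Q ∘ₗ g.lTensor M ∘ₗ h = TensorProduct.map f g ∘ₗ h := by
  rw [← LinearMap.comp_assoc, LinearMap.rTensor_comp_lTensor]

end TensorComp

/-- **Statement 6** (Proposition at the end of Section 6).
Let `H` be a graded Hopf algebra and `(G,μ,λ)` a graded left `H`-comodule algebra.
Given an `l`-deformation `(H[t]/(t^{l+1}), m^l, Δ^l)` of `H` and a compatible
`l`-deformation `(G[t]/(t^{l+1}), μ^l, λ^l)` of `G`, with degree `−s` coefficients
`m^l_s, Δ^l_s, μ^l_s, λ^l_s`, the total 2-cochain `(μ^l₁ + m^l₁) + (λ^l₁, Δ^l₁)`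
is a 2-cocycle of the total complex of the deformation bicomplex:
`(μ^l₁, m^l₁) + (λ^l₁, Δ^l₁) ∈ Z²_{ca}(G,H)`. -/
theorem stmt_6 (k : Type) [Field k]
    (H : Type) [Ring H] [HopfAlgebra k H]
    (G : Type) [Ring G] [Algebra k G] (c : ComodAlg k H G)
    -- gradings of `H` and of `G`:
    (𝒢H : ℕ → Submodule k H) (𝒢G : ℕ → Submodule k G)
    (hHsup : (⨆ i, 𝒢H i) = ⊤) (hHindep : iSupIndep 𝒢H)
    (hGsup : (⨆ i, 𝒢G i) = ⊤) (hGindep : iSupIndep 𝒢G)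
    (hHmul : ∀ i j, 𝒢H i * 𝒢H j ≤ 𝒢H (i + j))
    (hHcomul : ∀ s, Submodule.map (Coalgebra.comul (R := k) (A := H)) (𝒢H s)
      ≤ ⨆ i ∈ Finset.range (s + 1), tsub k (𝒢H i) (𝒢H (s - i)))
    (hGmul : ∀ i j, 𝒢G i * 𝒢G j ≤ 𝒢G (i + j))
    (hGcomul : ∀ s, Submodule.map c.lam.toLinearMap (𝒢G s)
      ≤ ⨆ i ∈ Finset.range (s + 1), tsub k (𝒢H i) (𝒢G (s - i)))
    -- the coefficients of the `l`-deformation of `H` and of `G`: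
    (l : ℕ) (hl : 1 ≤ l)
    (ms : ℕ → (H ⊗[k] H →ₗ[k] H)) (Δs : ℕ → (H →ₗ[k] H ⊗[k] H))
    (μs : ℕ → (G ⊗[k] G →ₗ[k] G)) (las : ℕ → (G →ₗ[k] H ⊗[k] G))
    (hms0 : ms 0 = LinearMap.mul' k H) (hΔs0 : Δs 0 = Coalgebra.comul (R := k))
    (hμs0 : μs 0 = LinearMap.mul' k G) (hlas0 : las 0 = c.lam.toLinearMap)
    (hmsl : ∀ s, l < s → ms s = 0) (hΔsl : ∀ s, l < s → Δs s = 0)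
    (hμsl : ∀ s, l < s → μs s = 0) (hlasl : ∀ s, l < s → las s = 0)
    -- the maps `m^l_s, Δ^l_s, μ^l_s, λ^l_s` are homogeneous of degree `−s`:
    (hmsdeg : ∀ s a b, Submodule.map (ms s) (tsub k (𝒢H a) (𝒢H b))
      ≤ if s ≤ a + b then 𝒢H (a + b - s) else ⊥)
    (hΔsdeg : ∀ s a, Submodule.map (Δs s) (𝒢H a)
      ≤ ⨆ (i : ℕ) (j : ℕ) (_ : i + j + s = a), tsub k (𝒢H i) (𝒢H j))
    (hμsdeg : ∀ s a b, Submodule.map (μs s) (tsub k (𝒢G a) (𝒢G b))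
      ≤ if s ≤ a + b then 𝒢G (a + b - s) else ⊥)
    (hlasdeg : ∀ s a, Submodule.map (las s) (𝒢G a)
      ≤ ⨆ (i : ℕ) (j : ℕ) (_ : i + j + s = a), tsub k (𝒢H i) (𝒢G j))
    -- `(H[t], m^l, Δ^l)` is a bialgebra deformation: associativity,
    -- coassociativity and compatibility, coefficientwise for all `n ≤ l`:
    (hassoc : ∀ n ≤ l,
      (∑ i ∈ Finset.range (n + 1), (ms i) ∘ₗ (ms (n - i)).rTensor H)
        = ∑ i ∈ Finset.range (n + 1),
            (ms i) ∘ₗ (ms (n - i)).lTensor H ∘ₗ (TensorProduct.assoc k H H H).toLinearMap)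
    (hcoassoc : ∀ n ≤ l,
      (∑ i ∈ Finset.range (n + 1), (TensorProduct.assoc k H H H).toLinearMap ∘ₗ
          (Δs i).rTensor H ∘ₗ Δs (n - i))
        = ∑ i ∈ Finset.range (n + 1), (Δs i).lTensor H ∘ₗ Δs (n - i))
    (hcompat : ∀ n ≤ l,
      (∑ i ∈ Finset.range (n + 1), (Δs i) ∘ₗ ms (n - i))
        = ∑ i ∈ Finset.range (n + 1), ∑ j ∈ Finset.range (n + 1 - i),
            ∑ p ∈ Finset.range (n + 1 - i - j),
            TensorProduct.map (ms i) (ms j) ∘ₗ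
              (TensorProduct.tensorTensorTensorComm k H H H H).toLinearMap ∘ₗ
              TensorProduct.map (Δs p) (Δs (n - i - j - p)))
    -- `(G[t], μ^l, λ^l)` is a compatible comodule-algebra deformation,
    -- equations (5.1), (5.2), (5.3), coefficientwise for all `n ≤ l`:
    (hdef1 : ∀ n ≤ l,
      (∑ i ∈ Finset.range (n + 1), (μs i) ∘ₗ (μs (n - i)).rTensor G)
        = ∑ i ∈ Finset.range (n + 1),
            (μs i) ∘ₗ (μs (n - i)).lTensor G ∘ₗ (TensorProduct.assoc k G G G).toLinearMap)
    (hdef2 : ∀ n ≤ l,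
      (∑ i ∈ Finset.range (n + 1), (las i).lTensor H ∘ₗ las (n - i))
        = ∑ i ∈ Finset.range (n + 1), (TensorProduct.assoc k H H G).toLinearMap ∘ₗ
            (Δs i).rTensor G ∘ₗ las (n - i))
    (hdef3 : ∀ n ≤ l,
      (∑ i ∈ Finset.range (n + 1), (las i) ∘ₗ μs (n - i))
        = ∑ i ∈ Finset.range (n + 1), ∑ j ∈ Finset.range (n + 1 - i),
            ∑ p ∈ Finset.range (n + 1 - i - j),
            TensorProduct.map (ms i) (μs j) ∘ₗ
              (TensorProduct.tensorTensorTensorComm k H G H G).toLinearMap ∘ₗ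
              TensorProduct.map (las p) (las (n - i - j - p))) :
    IsTwoCocycleCA k H G c (μs 1) (ms 1) (las 1) (Δs 1) := by
  have e1 := hdef1 1 hl
  have e2 := hdef2 1 hl
  have e3 := hassoc 1 hl
  have e4 := hcoassoc 1 hl
  have e5 := hcompat 1 hl
  have e6 := hdef3 1 hl
  simp only [Finset.sum_range_succ, Finset.sum_range_zero, zero_add, Nat.reduceAdd, Nat.reduceSub,
    tsub_zero, Nat.sub_self, hms0, hΔs0, hμs0, hlas0] at e1 e2 e3 e4 e5 e6
  refine ⟨?_, ?_, ?_, ?_, ?_, ?_⟩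
  · exact alternating_sum_eq_zero_of_add_eq_add e1
  · exact alternating_sum_eq_zero_of_add_eq_add' (A := G →ₗ[k] H ⊗[k] (H ⊗[k] G)) e2.symm
  · exact alternating_sum_eq_zero_of_add_eq_add e3
  · exact alternating_sum_eq_zero_of_add_eq_add' (A := H →ₗ[k] H ⊗[k] (H ⊗[k] H)) e4
  · simp only [codiag2L, codiag2R, diag2L, diag2R, LinearMap.comp_assoc,
      LinearMap.rTensor_comp_lTensor, LinearMap.lTensor_comp_rTensor,
      lTensor_comp_rTensor_comp, rTensor_comp_lTensor_comp]
    refine Eq.trans ?_ (add_sub_add_eq_zero_of_add_eq_add e5)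
    abel
  · simp only [lam21, lam22, beta1L, beta1R, LinearMap.comp_assoc,
      LinearMap.rTensor_comp_lTensor, LinearMap.lTensor_comp_rTensor,
      lTensor_comp_rTensor_comp, rTensor_comp_lTensor_comp]
    refine Eq.trans ?_ (add_sub_add_eq_zero_of_add_eq_add e6)
    abel

end HopfPaper
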